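/- For every odd n = 2k+1 with k ≥ 1 and each fixed choice of signs ε_j ∈ {+1,−1} (j = 0,…,k−1), the n-dimensional ℝ-algebra with basis η₁,…,η_n and relations, for j = 0,…,k−1: η_{2j+1}⋆η_{2j+1} = 2η_{2j+1}, η_{2j+1}⋆η_{2j+2} = η_{2j+2}, η_{2j+1}⋆η_n = −η_{2j+1}, η_{2j+2}⋆η_{2j+2} = ε_j η_{2j+1}, η_{2j+2}⋆η_n = η_{2j+2}, η_n⋆η_{2j+1} = −η_{2j+1}, together with η_n⋆η_n = Σ_{i=0}^{k} η_{2i+1} (all other products zero), is a differentially non-degenerate left-symmetric algebra, i.e. it is left-symmetric and the coefficients σ₁,…,σ_n of the characteristic polynomial of its right-adjoint operator are algebraically independent over ℝ. -/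

import Mathlib

open Matrix

/-- Components `N^i_{jk}` of the Nijenhuis torsion of a matrix-valued operator
field `L` on `ℝⁿ` (with `L x i j = L^i_j(x)`). -/
noncomputable def nijTorsion {n : ℕ} (L : (Fin n → ℝ) → Matrix (Fin n) (Fin n) ℝ)
    (x : Fin n → ℝ) (i j k : Fin n) : ℝ :=
  ∑ s : Fin n,
    (L x s j * fderiv ℝ (fun y => L y i k) x (Pi.single s 1)
      - L x s k * fderiv ℝ (fun y => L y i j) x (Pi.single s 1)
      - L x i s * fderiv ℝ (fun y => L y s k) x (Pi.single j 1)
      + L x i s * fderiv ℝ (fun y => L y s j) x (Pi.single k 1))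

/-- `L` is a Nijenhuis operator: its Nijenhuis torsion vanishes identically. -/
def IsNijenhuis {n : ℕ} (L : (Fin n → ℝ) → Matrix (Fin n) (Fin n) ℝ) : Prop :=
  ∀ x i j k, nijTorsion L x i j k = 0

/-- Bilinear product on `ℝⁿ` with structure constants `a i j k`
(`ηᵢ ⋆ ηⱼ = ∑ₖ a i j k • ηₖ`). -/
def mulSC {n : ℕ} (a : Fin n → Fin n → Fin n → ℝ) (ξ η : Fin n → ℝ) : Fin n → ℝ :=
  fun k => ∑ i : Fin n, ∑ j : Fin n, a i j k * ξ i * η j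

/-- Left-symmetry: the associator is symmetric in its first two arguments. -/
def IsLSA {n : ℕ} (a : Fin n → Fin n → Fin n → ℝ) : Prop :=
  ∀ ξ η ζ : Fin n → ℝ,
    mulSC a (mulSC a ξ η) ζ - mulSC a ξ (mulSC a η ζ)
      = mulSC a (mulSC a η ξ) ζ - mulSC a η (mulSC a ξ ζ)

/-- The right-adjoint operator field of the algebra with structure constants `a`:
`(R x) k i = ∑ j, a i j k * x j`, i.e. `(R x).mulVec ξ = ξ ⋆ x`. -/
def rightAdj {n : ℕ} (a : Fin n → Fin n → Fin n → ℝ) (x : Fin n → ℝ) :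
    Matrix (Fin n) (Fin n) ℝ :=
  Matrix.of fun k i => ∑ j : Fin n, a i j k * x j

/-- `charCoeff L i` is the coefficient `σ_{i+1}` of `t^(n-1-i)` in the characteristic
polynomial `χ_{L(x)}(t) = tⁿ + σ₁(x) tⁿ⁻¹ + ⋯ + σₙ(x)` of `L(x)`. -/
noncomputable def charCoeff {n : ℕ} (L : (Fin n → ℝ) → Matrix (Fin n) (Fin n) ℝ)
    (i : Fin n) : (Fin n → ℝ) → ℝ :=
  fun x => (L x).charpoly.coeff (n - 1 - (i : ℕ))

/-- A (structure-constant) algebra is differentially non-degenerate if the coefficients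
of the characteristic polynomial of its right-adjoint operator are algebraically
independent over `ℝ` (as elements of the algebra of real-valued functions). -/
def DiffNonDeg {n : ℕ} (a : Fin n → Fin n → Fin n → ℝ) : Prop :=
  AlgebraicIndependent ℝ (charCoeff (rightAdj a))

/-- Isomorphism of the algebras on `ℝⁿ` with structure constants `a` and `b`. -/
def AlgIsoSC {n : ℕ} (a b : Fin n → Fin n → Fin n → ℝ) : Prop :=
  ∃ φ : (Fin n → ℝ) ≃ₗ[ℝ] (Fin n → ℝ),
    ∀ ξ η : Fin n → ℝ, φ (mulSC a ξ η) = mulSC b (φ ξ) (φ η)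

/-- Jacobi matrix of a family of functions `σ` on `ℝⁿ`: `J i j = ∂σᵢ/∂xⱼ`. -/
noncomputable def jacobiMat {n : ℕ} (σ : Fin n → (Fin n → ℝ) → ℝ) (x : Fin n → ℝ) :
    Matrix (Fin n) (Fin n) ℝ :=
  Matrix.of fun i j => fderiv ℝ (σ i) x (Pi.single j 1)

/-- Companion-type matrix with first column `(-s 0, …, -s (n-1))ᵀ`, ones on the
superdiagonal and zeros elsewhere. -/
def companionS {n : ℕ} (s : Fin n → ℝ) : Matrix (Fin n) (Fin n) ℝ :=
  Matrix.of fun i j => if (j : ℕ) = 0 then -s i else if (j : ℕ) = (i : ℕ) + 1 then 1 else 0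

/-- Structure constants (0-indexed, on `ℝ^(2k+1)`) of the odd-dimensional family:
for `0 ≤ j ≤ k-1` (1-indexed relations):
`η_{2j+1}⋆η_{2j+1} = 2η_{2j+1}`, `η_{2j+1}⋆η_{2j+2} = η_{2j+2}`,
`η_{2j+1}⋆η_n = -η_{2j+1}`, `η_{2j+2}⋆η_{2j+2} = ε_j η_{2j+1}`,
`η_{2j+2}⋆η_n = η_{2j+2}`, `η_n⋆η_{2j+1} = -η_{2j+1}`,
and `η_n⋆η_n = ∑_{i=0}^{k} η_{2i+1}`. -/
def genAOdd (k : ℕ) (ε : ℕ → ℝ) : Fin (2 * k + 1) → Fin (2 * k + 1) → Fin (2 * k + 1) → ℝ :=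
  fun i j c =>
    if (i : ℕ) = 2 * k ∧ (j : ℕ) = 2 * k then (if (c : ℕ) % 2 = 0 then 1 else 0)
    else if (i : ℕ) = 2 * k then (if (j : ℕ) % 2 = 0 ∧ c = j then -1 else 0)
    else if (j : ℕ) = 2 * k then (if c = i then (if (i : ℕ) % 2 = 0 then -1 else 1) else 0)
    else if (i : ℕ) % 2 = 0 then
      (if j = i ∧ c = i then 2
       else if (j : ℕ) = (i : ℕ) + 1 ∧ (c : ℕ) = (i : ℕ) + 1 then 1 else 0)
    else (if j = i ∧ (c : ℕ) + 1 = (i : ℕ) then ε ((i : ℕ) / 2) else 0)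

/-- Splitting of `Fin (2 * k + 1)` into pairs `(2j, 2j + 1)` and the last index. -/
def pairIdx (k : ℕ) : Fin 2 × Fin k ⊕ Unit → Fin (2 * k + 1)
  | .inl (s, j) => ⟨2 * j + s, by omega⟩
  | .inr _ => ⟨2 * k, by omega⟩

lemma pairIdx_bijective (k : ℕ) : Function.Bijective (pairIdx k) := by
  refine (Fintype.bijective_iff_injective_and_card _).2 ⟨?_, by simp⟩
  rintro (⟨s, j⟩ | _) (⟨t, l⟩ | _) h <;> simp only [pairIdx, Fin.mk.injEq] at h
  · have h1 : j = l := by ext; omega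
    have h2 : s = t := by ext; omega
    rw [h1, h2]
  · omega
  · omega
  · rfl

noncomputable def pairEquiv (k : ℕ) : Fin 2 × Fin k ⊕ Unit ≃ Fin (2 * k + 1) :=
  Equiv.ofBijective _ (pairIdx_bijective k)

lemma sum_pairIdx {k : ℕ} (f : Fin (2 * k + 1) → ℝ) :
    ∑ i, f i = ∑ j, (f (pairIdx k (.inl (0, j))) + f (pairIdx k (.inl (1, j))))
      + f (pairIdx k (.inr ())) := by
  rw [← (pairEquiv k).sum_comp, Fintype.sum_sum_type, Fintype.sum_prod_type]
  simp [Finset.sum_add_distrib, pairEquiv]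

/-- The right-adjoint operator in the basis sorted by pairs. -/
lemma rightAdj_submatrix (k : ℕ) (ε : ℕ → ℝ) (x : Fin (2 * k + 1) → ℝ) :
    (rightAdj (genAOdd k ε) x).submatrix (pairIdx k) (pairIdx k) =
      fromBlocks
        (blockDiagonal fun j : Fin k =>
          !![2 * x (pairIdx k (.inl (0, j))) - x (pairIdx k (.inr ())),
              ε j * x (pairIdx k (.inl (1, j)));
            x (pairIdx k (.inl (1, j))), x (pairIdx k (.inr ()))])
        (of fun p _ => if p.1 = 0 then
          x (pairIdx k (.inr ())) - x (pairIdx k (.inl (0, p.2))) else 0)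
        0 (of fun _ _ => x (pairIdx k (.inr ()))) := by
  have hne (j : Fin k) : (j : ℕ) ≠ k := j.2.ne
  have hp (a b : ℕ) : 2 * a ≠ 2 * b + 1 := by omega
  have hp' (a b : ℕ) : 2 * a + 1 ≠ 2 * b := by omega
  have hd (a : ℕ) : (2 * a + 1) / 2 = a := by omega
  have hne' (j : Fin k) : k ≠ (j : ℕ) := j.2.ne'
  ext (⟨s, j⟩ | _) (⟨t, l⟩ | _)
  · rcases eq_or_ne j l with rfl | hjl
    · fin_cases s <;> fin_cases t <;>
        simp [rightAdj, sum_pairIdx, genAOdd, pairIdx, hne, hp, hp', hd, blockDiagonal_apply,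
          ← Fin.ext_iff, sub_eq_add_neg]
    · fin_cases s <;> fin_cases t <;>
        simp [rightAdj, sum_pairIdx, genAOdd, pairIdx, hne, hp, hp', blockDiagonal_apply,
          ← Fin.ext_iff, hjl]
  · fin_cases s <;>
      simp [rightAdj, sum_pairIdx, genAOdd, pairIdx, hne, hp', ← Fin.ext_iff, neg_add_eq_sub]
  · fin_cases t <;>
      simp [rightAdj, sum_pairIdx, genAOdd, pairIdx, hne, hne', hp, hp']
  · simp [rightAdj, sum_pairIdx, genAOdd, pairIdx, hne, hne', hp']

lemma mulSC_eq_rightAdj_mulVec {n : ℕ} (a : Fin n → Fin n → Fin n → ℝ) (ξ η : Fin n → ℝ) :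
    mulSC a ξ η = rightAdj a η *ᵥ ξ := by
  ext c
  simp only [mulSC, mulVec, dotProduct, rightAdj, of_apply, Finset.sum_mul]
  exact Finset.sum_congr rfl fun i _ => Finset.sum_congr rfl fun j _ => by ring

lemma mulSC_genAOdd_pairIdx (k : ℕ) (ε : ℕ → ℝ) (ξ η : Fin (2 * k + 1) → ℝ)
    (p : Fin 2 × Fin k ⊕ Unit) :
    mulSC (genAOdd k ε) ξ η (pairIdx k p) =
      ((rightAdj (genAOdd k ε) η).submatrix (pairIdx k) (pairIdx k) *ᵥ (ξ ∘ pairIdx k)) p := by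
  rw [mulSC_eq_rightAdj_mulVec]
  exact ((pairEquiv k).sum_comp _).symm

lemma mulSC_genAOdd_fst (k : ℕ) (ε : ℕ → ℝ) (ξ η : Fin (2 * k + 1) → ℝ) (j : Fin k) :
    mulSC (genAOdd k ε) ξ η (pairIdx k (.inl (0, j))) =
      (2 * η (pairIdx k (.inl (0, j))) - η (pairIdx k (.inr ()))) * ξ (pairIdx k (.inl (0, j)))
      + ε j * η (pairIdx k (.inl (1, j))) * ξ (pairIdx k (.inl (1, j)))
      + (η (pairIdx k (.inr ())) - η (pairIdx k (.inl (0, j)))) * ξ (pairIdx k (.inr ())) := by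
  rw [mulSC_genAOdd_pairIdx, rightAdj_submatrix, fromBlocks_mulVec]
  simp [mulVec, dotProduct, Fintype.sum_prod_type, blockDiagonal_apply]

lemma mulSC_genAOdd_snd (k : ℕ) (ε : ℕ → ℝ) (ξ η : Fin (2 * k + 1) → ℝ) (j : Fin k) :
    mulSC (genAOdd k ε) ξ η (pairIdx k (.inl (1, j))) =
      η (pairIdx k (.inl (1, j))) * ξ (pairIdx k (.inl (0, j)))
      + η (pairIdx k (.inr ())) * ξ (pairIdx k (.inl (1, j))) := by
  rw [mulSC_genAOdd_pairIdx, rightAdj_submatrix, fromBlocks_mulVec]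
  simp [mulVec, dotProduct, Fintype.sum_prod_type, blockDiagonal_apply]

lemma mulSC_genAOdd_last (k : ℕ) (ε : ℕ → ℝ) (ξ η : Fin (2 * k + 1) → ℝ) :
    mulSC (genAOdd k ε) ξ η (pairIdx k (.inr ())) =
      η (pairIdx k (.inr ())) * ξ (pairIdx k (.inr ())) := by
  rw [mulSC_genAOdd_pairIdx, rightAdj_submatrix, fromBlocks_mulVec]
  simp [mulVec, dotProduct]

lemma isLSA_genAOdd (k : ℕ) (ε : ℕ → ℝ) : IsLSA (genAOdd k ε) := by
  intro ξ η ζ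
  ext c
  obtain ⟨p, rfl⟩ := (pairIdx_bijective k).2 c
  rcases p with ⟨s, j⟩ | u
  · fin_cases s <;>
      simp only [Fin.zero_eta, Fin.mk_one, Pi.sub_apply, mulSC_genAOdd_fst, mulSC_genAOdd_snd,
        mulSC_genAOdd_last] <;> ring
  · cases u
    simp only [Pi.sub_apply, mulSC_genAOdd_last]
    ring

open Polynomial in
lemma charpoly_blockDiagonal {R m o : Type*} [CommRing R] [Fintype m] [DecidableEq m]
    [Fintype o] [DecidableEq o] (M : o → Matrix m m R) :
    (blockDiagonal M).charpoly = ∏ j, (M j).charpoly := by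
  simp only [Matrix.charpoly, ← det_blockDiagonal]
  congr 1
  ext ⟨i, a⟩ ⟨j, b⟩ : 2
  rcases eq_or_ne a b with rfl | hab
  · simp [charmatrix_apply, blockDiagonal_apply, diagonal_apply]
  · simp [blockDiagonal_apply, hab]

open Polynomial in
lemma charpoly_rightAdj_genAOdd (k : ℕ) (ε : ℕ → ℝ) (x : Fin (2 * k + 1) → ℝ) :
    (rightAdj (genAOdd k ε) x).charpoly =
      (∏ j : Fin k, (X ^ 2 - C (2 * x (pairIdx k (.inl (0, j)))) * X
        + C ((2 * x (pairIdx k (.inl (0, j))) - x (pairIdx k (.inr ()))) * x (pairIdx k (.inr ()))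
          - ε j * x (pairIdx k (.inl (1, j))) ^ 2))) * (X - C (x (pairIdx k (.inr ())))) := by
  have h := charpoly_reindex (pairEquiv k).symm (rightAdj (genAOdd k ε) x)
  rw [reindex_apply, Equiv.symm_symm] at h
  rw [← h]
  change ((rightAdj (genAOdd k ε) x).submatrix (pairIdx k) (pairIdx k)).charpoly = _
  rw [rightAdj_submatrix, charpoly_fromBlocks_zero₂₁, charpoly_blockDiagonal]
  congr 1
  · refine Finset.prod_congr rfl fun j _ => ?_
    rw [charpoly_fin_two, trace_fin_two_of, det_fin_two_of]
    simp only [map_add, map_sub, map_mul, map_pow]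
    ring
  · simp [Matrix.charpoly]

/-- Functions realizing the elementary symmetric polynomials on a box with infinite sides
are algebraically independent. -/
lemma algebraicIndependent_of_eval_esymm {σ T : Type*} [Fintype σ] {n : ℕ}
    (hn : n ≤ Fintype.card σ) (F : Fin n → T → ℝ) (S : σ → Set ℝ) (hS : ∀ i, (S i).Infinite)
    (hF : ∀ z ∈ Set.pi Set.univ S, ∃ x, ∀ i : Fin n,
      F i x = MvPolynomial.eval z (MvPolynomial.esymm σ ℝ (i + 1))) :
    AlgebraicIndependent ℝ F := by
  rw [AlgebraicIndependent, injective_iff_map_eq_zero]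
  intro P hP
  apply MvPolynomial.esymmAlgHom_injective (σ := σ) ℝ hn
  apply Subtype.ext
  rw [map_zero, MvPolynomial.esymmAlgHom_apply]
  refine MvPolynomial.funext_set S hS fun z hz => ?_
  obtain ⟨x, hx⟩ := hF z hz
  have h1 : MvPolynomial.aeval (fun i => F i x) P = 0 := by
    have h2 := congrArg (Pi.evalAlgHom ℝ (fun _ : T => ℝ) x) hP
    rwa [← AlgHom.comp_apply, MvPolynomial.comp_aeval] at h2
  simp only [hx] at h1
  rw [← MvPolynomial.coe_aeval_eq_eval] at h1 ⊢
  change (MvPolynomial.aeval z) _ = _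
  rw [← AlgHom.comp_apply, MvPolynomial.comp_aeval]
  simpa using h1

lemma exists_charpoly_rightAdj_genAOdd (k : ℕ) (ε : ℕ → ℝ) (z : Fin 2 × Fin k ⊕ Unit → ℝ)
    (hz : ∀ j : Fin k, ∃ b, ε j * b ^ 2 =
      -((z (.inl (0, j)) - z (.inr ())) * (z (.inl (1, j)) - z (.inr ())))) :
    ∃ x, (rightAdj (genAOdd k ε) x).charpoly =
      ∏ i, (Polynomial.X + Polynomial.C (z i)) := by
  choose b hb using hz
  let y : Fin 2 × Fin k ⊕ Unit → ℝ
    | .inl (s, j) => if s = 0 then -(z (.inl (0, j)) + z (.inl (1, j))) / 2 else b j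
    | .inr _ => -z (.inr ())
  have hy (p) : (y ∘ (pairEquiv k).symm) (pairIdx k p) = y p :=
    congrArg y ((pairEquiv k).symm_apply_apply p)
  refine ⟨y ∘ (pairEquiv k).symm, ?_⟩
  rw [charpoly_rightAdj_genAOdd, Fintype.prod_sum_type, Fintype.prod_prod_type_right]
  simp only [hy, Fin.prod_univ_two, Finset.univ_unique, Finset.prod_singleton]
  congr 1
  · refine Finset.prod_congr rfl fun j _ => ?_
    have h0 : (2 * y (.inl (0, j)) - y (.inr ())) * y (.inr ()) - ε j * y (.inl (1, j)) ^ 2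
        = z (.inl (0, j)) * z (.inl (1, j)) := by
      simp only [y, if_true, one_ne_zero, if_false, hb]
      ring
    have h1 : 2 * y (.inl (0, j)) = -(z (.inl (0, j)) + z (.inl (1, j))) := by
      simp only [y, if_true]
      ring
    rw [h0, h1]
    simp only [map_neg, map_add, map_mul]
    ring
  · simp [y]

lemma diffNonDeg_genAOdd (k : ℕ) (ε : ℕ → ℝ) (hε : ∀ j < k, ε j = 1 ∨ ε j = -1) :
    DiffNonDeg (genAOdd k ε) := by
  let S : Fin 2 × Fin k ⊕ Unit → Set ℝ
    | .inl (s, j) => if s = 1 ∧ ε j = 1 then Set.Iio 0 else Set.Ioi 1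
    | .inr _ => Set.Icc 0 1
  have hcard : Fintype.card (Fin 2 × Fin k ⊕ Unit) = 2 * k + 1 := by simp
  refine algebraicIndependent_of_eval_esymm hcard.ge _ S ?_ fun z hz => ?_
  · rintro (⟨s, j⟩ | _)
    · simp only [S]
      split_ifs
      · exact Set.Iio_infinite 0
      · exact Set.Ioi_infinite 1
    · exact Set.Icc_infinite one_pos
  · obtain ⟨x, hx⟩ := exists_charpoly_rightAdj_genAOdd k ε z fun j => by
      have h0 : 1 < z (.inl (0, j)) := by simpa [S] using hz (.inl (0, j)) trivial
      have h1 := hz (.inl (1, j)) trivial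
      have h2 : z (.inr ()) ∈ Set.Icc (0 : ℝ) 1 := hz (.inr ()) trivial
      rcases hε j j.2 with h | h
      · simp only [S, h, and_self, if_true, Set.mem_Iio] at h1
        refine ⟨√(-((z (.inl (0, j)) - z (.inr ())) * (z (.inl (1, j)) - z (.inr ())))), ?_⟩
        rw [Real.sq_sqrt (by nlinarith [h2.1, h2.2]), h, one_mul]
      · have h1' : 1 < z (.inl (1, j)) := by
          norm_num [S, h] at h1
          exact h1
        refine ⟨√((z (.inl (0, j)) - z (.inr ())) * (z (.inl (1, j)) - z (.inr ()))), ?_⟩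
        rw [Real.sq_sqrt (by nlinarith [h2.1, h2.2]), h, neg_one_mul]
    refine ⟨x, fun i => ?_⟩
    have hi := i.2
    rw [charCoeff, hx, ← MvPolynomial.coe_aeval_eq_eval]
    change _ = MvPolynomial.aeval z _
    rw [MvPolynomial.aeval_esymm_eq_multiset_esymm]
    have := Multiset.prod_X_add_C_coeff (Finset.univ.val.map z) (k := 2 * k + 1 - 1 - i)
      (by rw [Multiset.card_map, Finset.card_val, Finset.card_univ, hcard]; omega)
    rw [Multiset.map_map, Multiset.card_map, Finset.card_val, Finset.card_univ, hcard] at this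
    rw [show (i : ℕ) + 1 = 2 * k + 1 - (2 * k + 1 - 1 - i) by omega]
    exact this

/-- For every odd `n = 2k+1`, `k ≥ 1`, and every choice of signs `ε_j ∈ {1, -1}`,
the above algebra is a differentially non-degenerate left-symmetric algebra. -/
theorem stmt19 (k : ℕ) (hk : 1 ≤ k) (ε : ℕ → ℝ)
    (hε : ∀ j < k, ε j = 1 ∨ ε j = -1) :
    IsLSA (genAOdd k ε) ∧ DiffNonDeg (genAOdd k ε) := by
  exact ⟨isLSA_genAOdd k ε, diffNonDeg_genAOdd k ε hε⟩
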